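/- Let w ∈ S_n, ℓ ∈ [n], and i = Qind(w). Then a_w·t_ℓ − m_{Q_i,ℓ}·a_w lies in the k-linear span of {a_v : v ∈ S_n, Qind(v) < i}. -/

import Mathlib

noncomputable section

namespace OneSidedCycleShuffles

/-- `sw n i` is the simple transposition `s_i ∈ S_n` (1-indexed: it swaps the values `i` and
`i+1` of `[n] = {1,…,n}`, realized on the carrier `Fin n` via the identification
`x ∈ [n] ↔ ⟨x-1⟩ : Fin n`); it is the junk value `1` unless `i ∈ [n-1]`. -/
def sw (n i : ℕ) : Equiv.Perm (Fin n) :=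
  if h : 1 ≤ i ∧ i < n then Equiv.swap ⟨i - 1, by omega⟩ ⟨i, h.2⟩ else 1

/-- `cyc n l j` is the cycle `cyc_{l,l+1,…,j} ∈ S_n` (sending `l,…,j-1,j` to `l+1,…,j,l`),
written as the product `s_l s_{l+1} ⋯ s_{j-1}` of simple transpositions. -/
def cyc (n l j : ℕ) : Equiv.Perm (Fin n) :=
  ((List.range' l (j - l)).map (sw n)).prod

/-- The somewhere-to-below shuffle `t_ℓ = cyc_ℓ + cyc_{ℓ,ℓ+1} + ⋯ + cyc_{ℓ,ℓ+1,…,n} ∈ k[S_n]`. -/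
def t (n : ℕ) (k : Type*) [CommRing k] (l : ℕ) : MonoidAlgebra k (Equiv.Perm (Fin n)) :=
  ∑ j ∈ Finset.Icc l n, MonoidAlgebra.of k (Equiv.Perm (Fin n)) (cyc n l j)

/-- `m_{I,ℓ}` : (the smallest element of the enclosure `{0} ∪ I ∪ {n+1}` that is `≥ ℓ`) `- ℓ`. -/
def mIdx (n : ℕ) (I : Finset ℕ) (l : ℕ) : ℕ :=
  sInf {x : ℕ | (x = 0 ∨ x ∈ I ∨ x = n + 1) ∧ l ≤ x} - l

/-- The non-shadow `I' = [n-1] \ (I ∪ (I-1))`. -/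
def nonShadow (n : ℕ) (I : Finset ℕ) : Finset ℕ :=
  Finset.Icc 1 (n - 1) \ (I ∪ I.image (fun i => i - 1))

/-- A set of integers is lacunar if it contains no two consecutive integers. -/
def Lacunar (I : Finset ℕ) : Prop := ∀ i ∈ I, i + 1 ∉ I

instance : DecidablePred Lacunar := fun I =>
  decidable_of_iff (∀ i ∈ I, i + 1 ∉ I) Iff.rfl

/-- The invariant space `F(I) = {q ∈ k[S_n] : q s_i = q for all i ∈ I'}`. -/
def F (n : ℕ) (k : Type*) [CommRing k] (I : Finset ℕ) :
    Submodule k (MonoidAlgebra k (Equiv.Perm (Fin n))) where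
  carrier := {q | ∀ i ∈ nonShadow n I, q * MonoidAlgebra.of k (Equiv.Perm (Fin n)) (sw n i) = q}
  add_mem' := by
    intro a b ha hb i hi
    rw [add_mul, ha i hi, hb i hi]
  zero_mem' := by
    intro i hi
    rw [zero_mul]
  smul_mem' := by
    intro c a ha i hi
    rw [smul_mul_assoc, ha i hi]

/-- `F(<c) = ∑_{J ⊆ [n], sum J < c} F(J)`. -/
def Flt (n : ℕ) (k : Type*) [CommRing k] (c : ℕ) :
    Submodule k (MonoidAlgebra k (Equiv.Perm (Fin n))) :=
  ∑ J ∈ (Finset.Icc 1 n).powerset.filter (fun J => J.sum id < c), F n k J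

/-- `F_i = F(Q_1) + ⋯ + F(Q_i)` for an enumeration `Q` of the lacunar subsets of `[n-1]`. -/
def Fi (n : ℕ) (k : Type*) [CommRing k] (Q : ℕ → Finset ℕ) (i : ℕ) :
    Submodule k (MonoidAlgebra k (Equiv.Perm (Fin n))) :=
  ∑ j ∈ Finset.Icc 1 i, F n k (Q j)

/-- The (1-indexed) value `w(i) ∈ [n]` of a permutation `w ∈ S_n` at `i ∈ [n]`
(junk value `0` if out of range). -/
def pval (n : ℕ) (w : Equiv.Perm (Fin n)) (i : ℕ) : ℕ :=
  if h : i - 1 < n then (w ⟨i - 1, h⟩).val + 1 else 0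

/-- The descent set `Des w = {i ∈ [n-1] : w(i) > w(i+1)}`. -/
def Des (n : ℕ) (w : Equiv.Perm (Fin n)) : Finset ℕ :=
  (Finset.Icc 1 (n - 1)).filter fun i => pval n w (i + 1) < pval n w i

/-- `G(T)` : the subgroup of `S_n` generated by the simple transpositions `s_i`, `i ∈ T`. -/
def G (n : ℕ) (T : Finset ℕ) : Subgroup (Equiv.Perm (Fin n)) :=
  Subgroup.closure ((T.image (sw n) : Finset (Equiv.Perm (Fin n))) : Set (Equiv.Perm (Fin n)))

open scoped Classical in
/-- `a_w = ∑_{σ ∈ G(Des w)} wσ ∈ k[S_n]`. -/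
def aw (n : ℕ) (k : Type*) [CommRing k] (w : Equiv.Perm (Fin n)) :
    MonoidAlgebra k (Equiv.Perm (Fin n)) :=
  ∑ σ ∈ Finset.univ.filter (fun σ => σ ∈ G n (Des n w)),
    MonoidAlgebra.of k (Equiv.Perm (Fin n)) (w * σ)

/-- The Q-index of `w` : the smallest `i ∈ [f_{n+1}]` with `Q_i' ⊆ Des w`. -/
def Qind (n : ℕ) (Q : ℕ → Finset ℕ) (w : Equiv.Perm (Fin n)) : ℕ :=
  sInf {i : ℕ | 1 ≤ i ∧ i ≤ Nat.fib (n + 1) ∧ nonShadow n (Q i) ⊆ Des n w}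

/-- The set of inversions of `u ∈ S_n` : pairs `(i,j) ∈ [n] × [n]` with `i < j`, `u(i) > u(j)`. -/
def InvSet (n : ℕ) (u : Equiv.Perm (Fin n)) : Finset (ℕ × ℕ) :=
  (Finset.Icc 1 n ×ˢ Finset.Icc 1 n).filter fun p => p.1 < p.2 ∧ pval n u p.2 < pval n u p.1

/-- The lexicographic order on `S_n` : `u < v` iff at the smallest `i ∈ [n]` where they
differ, `u(i) < v(i)`. -/
def lexLT (n : ℕ) (u v : Equiv.Perm (Fin n)) : Prop :=
  ∃ i ∈ Finset.Icc 1 n, pval n u i < pval n v i ∧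
    ∀ j ∈ Finset.Icc 1 n, j < i → pval n u j = pval n v j

/-- `Z(I) = {q ∈ k[S_n] : q s_i = q for all i ∈ I}`. -/
def Z (n : ℕ) (k : Type*) [CommRing k] (I : Finset ℕ) :
    Submodule k (MonoidAlgebra k (Equiv.Perm (Fin n))) where
  carrier := {q | ∀ i ∈ I, q * MonoidAlgebra.of k (Equiv.Perm (Fin n)) (sw n i) = q}
  add_mem' := by
    intro a b ha hb i hi
    rw [add_mul, ha i hi, hb i hi]
  zero_mem' := by
    intro i hi
    rw [zero_mul]
  smul_mem' := by
    intro c a ha i hi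
    rw [smul_mul_assoc, ha i hi]

/-- `R(x)` : right multiplication by `x`, as a `k`-module endomorphism of `k[S_n]`. -/
def Rmul (n : ℕ) (k : Type*) [CommRing k] (x : MonoidAlgebra k (Equiv.Perm (Fin n))) :
    Module.End k (MonoidAlgebra k (Equiv.Perm (Fin n))) :=
  LinearMap.mulRight k x

lemma mem_nonShadow {n : ℕ} {I : Finset ℕ} {p : ℕ} :
    p ∈ nonShadow n I ↔ (1 ≤ p ∧ p < n) ∧ p ∉ I ∧ p + 1 ∉ I := by
  simp only [nonShadow, Finset.mem_sdiff, Finset.mem_Icc, Finset.mem_union, Finset.mem_image,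
    not_or, not_exists, not_and]
  constructor
  · rintro ⟨⟨h1, h2⟩, h3, h4⟩
    exact ⟨⟨h1, by omega⟩, h3, fun h => h4 _ h (by omega)⟩
  · rintro ⟨⟨h1, h2⟩, h3, h4⟩
    refine ⟨⟨h1, by omega⟩, h3, fun x hx hxp => h4 ?_⟩
    have : x = p + 1 := by omega
    rwa [← this]

/-! ### Simple transpositions and cycles -/

lemma sw_apply_val {n i : ℕ} (h : 1 ≤ i ∧ i < n) (x : Fin n) :
    (sw n i x).val = if x.val = i - 1 then i else if x.val = i then i - 1 else x.val := by
  simp only [sw, dif_pos h, Equiv.swap_apply_def, Fin.ext_iff]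
  split_ifs <;> rfl

lemma sw_mul_self (n i : ℕ) : sw n i * sw n i = 1 := by
  unfold sw
  split_ifs <;> simp

lemma sw_commute (n : ℕ) {p q : ℕ} (h : p + 2 ≤ q ∨ q + 2 ≤ p) : Commute (sw n p) (sw n q) := by
  by_cases hp : 1 ≤ p ∧ p < n
  · by_cases hq : 1 ≤ q ∧ q < n
    · ext x
      simp only [Equiv.Perm.mul_apply, sw_apply_val hp, sw_apply_val hq]
      grind
    · simp [sw, dif_neg hq]
  · simp [sw, dif_neg hp]

lemma sw_braid {n p : ℕ} (hp : 1 ≤ p) (hn : p + 2 ≤ n) :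
    sw n p * sw n (p + 1) * sw n p = sw n (p + 1) * sw n p * sw n (p + 1) := by
  have h1 : 1 ≤ p ∧ p < n := by omega
  have h2 : 1 ≤ p + 1 ∧ p + 1 < n := by omega
  ext x
  simp only [Equiv.Perm.mul_apply, sw_apply_val h1, sw_apply_val h2]
  grind

lemma cyc_self (n l : ℕ) : cyc n l l = 1 := by simp [cyc]

lemma cyc_mul_cyc (n : ℕ) {l a j : ℕ} (h1 : l ≤ a) (h2 : a ≤ j) :
    cyc n l a * cyc n a j = cyc n l j := by
  obtain ⟨x, rfl⟩ := Nat.exists_eq_add_of_le h1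
  obtain ⟨y, rfl⟩ := Nat.exists_eq_add_of_le h2
  have h := List.range'_append (s := l) (m := x) (n := y) (step := 1)
  simp only [cyc, ← List.prod_append, ← List.map_append]
  rw [show l + x - l = x by omega, show l + x + y - (l + x) = y by omega,
    show l + x + y - l = x + y by omega, ← h]
  simp

lemma cyc_succ (n : ℕ) {l j : ℕ} (h : l ≤ j) : cyc n l (j + 1) = cyc n l j * sw n j := by
  rw [← cyc_mul_cyc n h j.le_succ]
  simp [cyc]

lemma cyc_commute_sw (n : ℕ) {l j p : ℕ} (h : j < p ∨ p + 1 < l) :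
    Commute (cyc n l j) (sw n p) := by
  apply Commute.list_prod_left
  intro y hy
  obtain ⟨q, hq, rfl⟩ := List.mem_map.1 hy
  rw [List.mem_range'_1] at hq
  exact sw_commute n (by omega)

lemma cyc_mul_sw {n l j p : ℕ} (hl : 1 ≤ l) (hp : l ≤ p) (hj : p + 2 ≤ j) (hn : j ≤ n) :
    cyc n l j * sw n p = sw n (p + 1) * cyc n l j := by
  induction j, hj using Nat.le_induction with
  | base =>
    rw [cyc_succ n (by omega), cyc_succ n hp]
    have h1 := sw_braid (n := n) (p := p) (by omega) (by omega)
    have h2 : Commute (cyc n l p) (sw n (p + 1)) := cyc_commute_sw n (by omega)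
    calc cyc n l p * sw n p * sw n (p + 1) * sw n p
        = cyc n l p * (sw n p * sw n (p + 1) * sw n p) := by simp only [mul_assoc]
      _ = cyc n l p * sw n (p + 1) * (sw n p * sw n (p + 1)) := by rw [h1]; simp only [mul_assoc]
      _ = _ := by rw [h2.eq]; simp only [mul_assoc]
  | succ j hj ih =>
    rw [cyc_succ n (by omega), mul_assoc, (sw_commute n (by omega) : Commute (sw n j) (sw n p)).eq,
      ← mul_assoc, ih (by omega), mul_assoc]

/-! ### Invariant elements under right multiplication -/

section Invariants

variable {n : ℕ} {k : Type*} [CommRing k]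

local notation "gr" => MonoidAlgebra.of k (Equiv.Perm (Fin n))

lemma mul_cyc_eq_self {q : MonoidAlgebra k (Equiv.Perm (Fin n))} {l j : ℕ}
    (h : ∀ p, l ≤ p → p < j → q * gr (sw n p) = q) : q * gr (cyc n l j) = q := by
  rcases le_total j l with hj | hj
  · rw [cyc, Nat.sub_eq_zero_of_le hj, List.range'_zero, List.map_nil, List.prod_nil, map_one,
      mul_one]
  induction j, hj using Nat.le_induction with
  | base => rw [cyc_self, map_one, mul_one]
  | succ j hj ih =>
    rw [cyc_succ n hj, map_mul, ← mul_assoc, ih fun p h1 h2 => h p h1 (by omega),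
      h j hj (by omega)]

/-- The largest element of `I` that is at most `j`. -/
def floorIn (I : Finset ℕ) (j : ℕ) : ℕ := (I.filter (· ≤ j)).sup id

lemma floorIn_eq_iff {I : Finset ℕ} {i : ℕ} (hi : i ∈ I) {j r : ℕ} (hj : i ≤ j) :
    floorIn I j = r ↔ r ∈ I ∧ r ≤ j ∧ ∀ x ∈ I, x ≤ j → x ≤ r := by
  have hne : (I.filter (· ≤ j)).Nonempty := ⟨i, by simp [hi, hj]⟩
  obtain ⟨x, hx, hxe⟩ := Finset.exists_mem_eq_sup _ hne id
  have hle : ∀ y ∈ I, y ≤ j → y ≤ floorIn I j := fun y hy hyj =>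
    Finset.le_sup (f := id) (Finset.mem_filter.2 ⟨hy, hyj⟩)
  rw [Finset.mem_filter] at hx
  have hxe' : floorIn I j = x := hxe
  constructor
  · rintro rfl
    exact ⟨hxe' ▸ hx.1, hxe' ▸ hx.2, hle⟩
  · rintro ⟨h1, h2, h3⟩
    exact le_antisymm (hxe' ▸ h3 x hx.1 hx.2) (hle r h1 h2)

/-- The set obtained from `I` by lowering its elements in `[i, r]` by one. -/
def lower (i r : ℕ) (I : Finset ℕ) : Finset ℕ :=
  I.image fun x => if i ≤ x ∧ x ≤ r then x - 1 else x

lemma sum_lower_lt {I : Finset ℕ} {i r : ℕ} (hi : i ∈ I) (h1 : 1 ≤ i) (hr : i ≤ r) :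
    (lower i r I).sum id < I.sum id := by
  refine (Finset.sum_image_le_of_nonneg (fun _ _ => Nat.zero_le _)).trans_lt
    (Finset.sum_lt_sum (fun x _ => ?_) ⟨i, hi, ?_⟩)
  · dsimp only [id]; split_ifs <;> omega
  · dsimp only [id]; split_ifs <;> omega

lemma sub_one_mem_lower {I : Finset ℕ} {i r x : ℕ} (hx : x ∈ I) (h1 : i ≤ x) (h2 : x ≤ r) :
    x - 1 ∈ lower i r I :=
  Finset.mem_image.2 ⟨x, hx, if_pos ⟨h1, h2⟩⟩

lemma mem_lower {I : Finset ℕ} {i r x : ℕ} (hx : x ∈ I) (h : x < i ∨ r < x) :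
    x ∈ lower i r I :=
  Finset.mem_image.2 ⟨x, hx, if_neg (by omega)⟩

lemma sum_mul_cyc_mem_F {I : Finset ℕ} {q : MonoidAlgebra k (Equiv.Perm (Fin n))}
    (hq : q ∈ F n k I) {i a r : ℕ} (hi : i ∈ I) (ha1 : 1 ≤ a) (hai : a ≤ i) (hia : i ≤ a + 1)
    (hir : i ≤ r) :
    ∑ j ∈ (Finset.Icc i n).filter (fun j => floorIn I j = r), q * gr (cyc n a j) ∈
      F n k (lower i r I) := by
  have key : ∀ {p : ℕ}, 1 ≤ p → p < n → p ∉ I → p + 1 ∉ I → q * gr (sw n p) = q :=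
    fun h1 h2 h3 h4 => hq _ (mem_nonShadow.2 ⟨⟨h1, h2⟩, h3, h4⟩)
  have hmem : ∀ j, j ∈ (Finset.Icc i n).filter (fun j => floorIn I j = r) ↔
      (i ≤ j ∧ j ≤ n) ∧ r ∈ I ∧ r ≤ j ∧ ∀ x ∈ I, x ≤ j → x ≤ r := by
    intro j
    rw [Finset.mem_filter, Finset.mem_Icc]
    exact and_congr_right fun h => floorIn_eq_iff hi h.1
  intro p hp
  rw [mem_nonShadow] at hp
  obtain ⟨⟨hp1, hpn⟩, hpK, hpK'⟩ := hp
  have hcomm : ∀ j, (j < p ∨ p + 1 < a) → q * gr (sw n p) = q →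
      q * gr (cyc n a j) * gr (sw n p) = q * gr (cyc n a j) := by
    intro j h h'
    rw [mul_assoc, ← map_mul, (cyc_commute_sw n h).eq, map_mul, ← mul_assoc, h']
  rw [Finset.sum_mul]
  by_cases hpa : p + 1 < a
  · refine Finset.sum_congr rfl fun j _ => hcomm j (Or.inr hpa) (key hp1 hpn ?_ ?_)
    · exact fun h => hpK (mem_lower h (by omega))
    · exact fun h => hpK' (mem_lower h (by omega))
  have hpi : i ≤ p := by
    have h := sub_one_mem_lower hi le_rfl hir
    by_contra hlt
    rcases (by omega : p = i - 1 ∨ p + 1 = i - 1) with h' | h'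
    · exact hpK (h' ▸ h)
    · exact hpK' (h' ▸ h)
  have hp1I : p + 1 ∉ I := by
    intro h
    rcases le_or_gt (p + 1) r with h' | h'
    · exact hpK (sub_one_mem_lower h (by omega) h')
    · exact hpK' (mem_lower h (Or.inr h'))
  have hswap : ∀ j, (i ≤ j ∧ j ≤ n) ∧ r ∈ I ∧ r ≤ j ∧ (∀ x ∈ I, x ≤ j → x ≤ r) →
      (i ≤ Equiv.swap p (p + 1) j ∧ Equiv.swap p (p + 1) j ≤ n) ∧ r ∈ I ∧
        r ≤ Equiv.swap p (p + 1) j ∧ ∀ x ∈ I, x ≤ Equiv.swap p (p + 1) j → x ≤ r := by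
    rintro j ⟨⟨h1, h2⟩, h3, h4, h5⟩
    rw [Equiv.swap_apply_def]
    split_ifs with hj hj
    · subst hj
      refine ⟨by omega, h3, by omega, fun x hx hxj => h5 x hx ?_⟩
      have : x ≠ j + 1 := fun h => hp1I (h ▸ hx)
      omega
    · subst hj
      have : r ≠ p + 1 := fun h => hp1I (h ▸ h3)
      exact ⟨by omega, h3, by omega, fun x hx hxj => h5 x hx (by omega)⟩
    · exact ⟨⟨h1, h2⟩, h3, h4, h5⟩
  refine Finset.sum_equiv (Equiv.swap p (p + 1)) (fun j => ?_) (fun j hj => ?_)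
  · rw [hmem, hmem]
    refine ⟨hswap j, fun h => ?_⟩
    simpa using hswap _ h
  · rw [hmem] at hj
    obtain ⟨⟨h1, h2⟩, h3, h4, h5⟩ := hj
    rw [Equiv.swap_apply_def]
    split_ifs with hjp hjp
    · rw [hjp, cyc_succ n (by omega), map_mul, mul_assoc]
    · rw [hjp, cyc_succ n (by omega), mul_assoc, ← map_mul, mul_assoc, sw_mul_self, mul_one]
    · rcases (by omega : j < p ∨ p + 2 ≤ j) with h | h
      · refine hcomm j (Or.inl h) (key hp1 hpn (fun hI => ?_) hp1I)
        exact hpK (mem_lower hI (by omega))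
      · rw [mul_assoc, ← map_mul, cyc_mul_sw ha1 (by omega) h h2, map_mul, ← mul_assoc,
          key (by omega) (by omega) hp1I]
        intro hI
        rcases le_or_gt (p + 2) r with h' | h'
        · exact hpK' (sub_one_mem_lower hI (by omega) h')
        · have := h5 _ hI h
          omega

lemma mIdx_spec (n : ℕ) (I : Finset ℕ) {l : ℕ} (h1 : 1 ≤ l) (hl : l ≤ n) :
    ∃ b, mIdx n I l = b - l ∧ (b ∈ I ∨ b = n + 1) ∧ l ≤ b ∧ b ≤ n + 1 ∧
      ∀ x ∈ I, l ≤ x → b ≤ x := by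
  have hne : n + 1 ∈ {x : ℕ | (x = 0 ∨ x ∈ I ∨ x = n + 1) ∧ l ≤ x} :=
    ⟨Or.inr (Or.inr rfl), by omega⟩
  have hmem := Nat.sInf_mem ⟨_, hne⟩
  refine ⟨_, rfl, ?_, hmem.2, Nat.sInf_le hne, fun x hx hlx =>
    Nat.sInf_le ⟨Or.inr (Or.inl hx), hlx⟩⟩
  rcases hmem.1 with h | h
  · have := hmem.2
    omega
  · exact h

lemma mul_t_sub_mem {I : Finset ℕ} {q : MonoidAlgebra k (Equiv.Perm (Fin n))}
    (hq : q ∈ F n k I) {l : ℕ} (hl : l ∈ Finset.Icc 1 n)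
    {M : Submodule k (MonoidAlgebra k (Equiv.Perm (Fin n)))}
    (hM : ∀ K : Finset ℕ, K.sum id < I.sum id → F n k K ≤ M) :
    q * t n k l - (mIdx n I l : k) • q ∈ M := by
  rw [Finset.mem_Icc] at hl
  obtain ⟨b, hm, hb, hlb, hbn, hmin⟩ := mIdx_spec n I hl.1 hl.2
  have hfix : ∀ j, j < b → q * gr (cyc n l j) = q := by
    intro j hj
    refine mul_cyc_eq_self fun p hp1 hp2 => hq p (mem_nonShadow.2 ⟨by omega, ?_, ?_⟩)
    · intro h
      have := hmin _ h hp1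
      omega
    · intro h
      have := hmin _ h (by omega)
      omega
  have hsplit : Finset.Icc l n = Finset.Ico l b ∪ Finset.Icc b n := by
    ext x
    simp only [Finset.mem_union, Finset.mem_Icc, Finset.mem_Ico]
    omega
  have hdisj : Disjoint (Finset.Ico l b) (Finset.Icc b n) := by
    rw [Finset.disjoint_left]
    simp only [Finset.mem_Icc, Finset.mem_Ico]
    omega
  have hlow : ∑ j ∈ Finset.Ico l b, q * gr (cyc n l j) = (mIdx n I l : k) • q := by
    rw [Finset.sum_congr rfl fun j hj => hfix j (Finset.mem_Ico.1 hj).2, Finset.sum_const,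
      Nat.card_Ico, hm, Nat.cast_smul_eq_nsmul]
  rw [t, Finset.mul_sum, hsplit, Finset.sum_union hdisj, hlow, add_sub_cancel_left]
  rcases hb with hb | rfl
  · obtain ⟨a, ha1, hab, hba, hcyc⟩ : ∃ a, 1 ≤ a ∧ a ≤ b ∧ b ≤ a + 1 ∧
        ∀ j ∈ Finset.Icc b n, q * gr (cyc n l j) = q * gr (cyc n a j) := by
      rcases hlb.eq_or_lt with rfl | hlt
      · exact ⟨l, hl.1, le_rfl, by omega, fun _ _ => rfl⟩
      · refine ⟨b - 1, by omega, by omega, by omega, fun j hj => ?_⟩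
        rw [Finset.mem_Icc] at hj
        rw [← cyc_mul_cyc n (a := b - 1) (by omega) (by omega), map_mul, ← mul_assoc,
          hfix _ (by omega)]
    rw [Finset.sum_congr rfl hcyc, ← Finset.sum_fiberwise_of_maps_to
      (g := floorIn I) (t := (Finset.Icc b n).image (floorIn I))
      (fun j hj => Finset.mem_image_of_mem _ hj)]
    refine Submodule.sum_mem _ fun r hr => ?_
    obtain ⟨j, hj, rfl⟩ := Finset.mem_image.1 hr
    have hbj := (Finset.mem_Icc.1 hj).1
    have hbr : b ≤ floorIn I j := ((floorIn_eq_iff hb hbj).1 rfl).2.2 b hb hbj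
    exact hM _ (sum_lower_lt hb (by omega) hbr) (sum_mul_cyc_mem_F hq hb ha1 hab hba hbr)
  · simp

/-! ### Reduction to lacunar sets -/

lemma exists_lacunar_nonShadow_subset (n : ℕ) (J : Finset ℕ) :
    ∃ K : Finset ℕ, K ⊆ Finset.Icc 1 (n - 1) ∧ Lacunar K ∧ K.sum id ≤ J.sum id ∧
      nonShadow n K ⊆ nonShadow n J := by
  induction hN : J.sum id + J.card using Nat.strong_induction_on generalizing J with
  | _ N ih =>
  have step : ∀ J' : Finset ℕ, J'.sum id ≤ J.sum id →
      J'.sum id + J'.card < N → nonShadow n J' ⊆ nonShadow n J →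
      ∃ K : Finset ℕ, K ⊆ Finset.Icc 1 (n - 1) ∧ Lacunar K ∧ K.sum id ≤ J.sum id ∧
        nonShadow n K ⊆ nonShadow n J := by
    intro J' h1 h3 h4
    obtain ⟨K, hK1, hK2, hK3, hK4⟩ := ih _ h3 J' rfl
    exact ⟨K, hK1, hK2, hK3.trans h1, hK4.trans h4⟩
  have replace : ∀ x ∈ J, nonShadow n (insert (x - 1) (J.erase x)) ⊆ nonShadow n J → 1 ≤ x →
      ∃ K : Finset ℕ, K ⊆ Finset.Icc 1 (n - 1) ∧ Lacunar K ∧ K.sum id ≤ J.sum id ∧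
        nonShadow n K ⊆ nonShadow n J := by
    intro x hx hsub hx1
    have hs : (insert (x - 1) (J.erase x)).sum id ≤ (x - 1) + (J.erase x).sum id := by
      by_cases h : x - 1 ∈ J.erase x
      · rw [Finset.insert_eq_of_mem h]
        omega
      · rw [Finset.sum_insert h]
        simp
    have hc := Finset.card_insert_le (x - 1) (J.erase x)
    have hs' := Finset.add_sum_erase J id hx
    have hc' := Finset.card_erase_add_one hx
    simp only [id] at hs hs' hN
    exact step _ (by simp only [id]; omega) (by simp only [id]; omega) hsub
  by_cases h0 : 0 ∈ J
  · have hs' := Finset.add_sum_erase J id h0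
    have hc' := Finset.card_erase_add_one h0
    simp only [id] at hs' hN
    refine step (J.erase 0) (by simp only [id]; omega) (by simp only [id]; omega) ?_
    intro p hp
    simp only [mem_nonShadow, Finset.mem_erase] at hp ⊢
    grind
  by_cases hbig : ∃ x ∈ J, n ≤ x
  · obtain ⟨x, hx, hnx⟩ := hbig
    refine replace x hx (fun p hp => ?_) (Nat.one_le_iff_ne_zero.2 fun h => h0 (h ▸ hx))
    simp only [mem_nonShadow, Finset.mem_erase, Finset.mem_insert] at hp ⊢
    grind
  by_cases hlac : Lacunar J
  · refine ⟨J, fun x hx => ?_, hlac, le_rfl, subset_rfl⟩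
    have h1 : x ≠ 0 := fun h => h0 (h ▸ hx)
    have h2 : ¬ n ≤ x := fun h => hbig ⟨x, hx, h⟩
    rw [Finset.mem_Icc]
    omega
  · simp only [Lacunar, not_forall, not_not] at hlac
    obtain ⟨x, hx, hx'⟩ := hlac
    refine replace x hx (fun p hp => ?_) (Nat.one_le_iff_ne_zero.2 fun h => h0 (h ▸ hx))
    simp only [mem_nonShadow, Finset.mem_erase, Finset.mem_insert] at hp ⊢
    grind

/-! ### The invariant spaces are spanned by the elements `a_w` -/

lemma mem_Des {w : Equiv.Perm (Fin n)} {p : ℕ} :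
    p ∈ Des n w ↔ ∃ h : 1 ≤ p ∧ p < n, w ⟨p, h.2⟩ < w ⟨p - 1, by omega⟩ := by
  simp only [Des, Finset.mem_filter, Finset.mem_Icc]
  constructor
  · rintro ⟨h1, h2⟩
    refine ⟨by omega, ?_⟩
    simpa [pval, show p < n by omega, show p - 1 < n by omega] using h2
  · rintro ⟨h1, h2⟩
    refine ⟨by omega, ?_⟩
    simpa [pval, show p < n by omega, show p - 1 < n by omega] using h2

lemma lt_iff_of_mem_G {T : Finset ℕ} {σ : Equiv.Perm (Fin n)} (hσ : σ ∈ G n T) {m : ℕ}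
    (hm : m ∉ T) (x : Fin n) : (σ x).val < m ↔ x.val < m := by
  induction hσ using Subgroup.closure_induction generalizing x with
  | mem σ h =>
    obtain ⟨p, hp, rfl⟩ := Finset.mem_image.1 (Finset.mem_coe.1 h)
    have hpm : p ≠ m := fun h => hm (h ▸ hp)
    by_cases hpn : 1 ≤ p ∧ p < n
    · rw [sw_apply_val hpn]
      split_ifs <;> omega
    · simp [sw, dif_neg hpn]
  | one => rfl
  | mul σ τ _ _ h1 h2 => rw [Equiv.Perm.mul_apply, h1, h2]
  | inv σ _ h => rw [← h, ← Equiv.Perm.mul_apply, mul_inv_cancel, Equiv.Perm.one_apply]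

/-- One-line notation of a permutation, in the lexicographically ordered set of words. -/
def word (w : Equiv.Perm (Fin n)) : Lex (Fin n → Fin n) := toLex w

lemma word_injective : Function.Injective (word (n := n)) := fun _ _ h =>
  DFunLike.coe_injective (toLex.injective h)

lemma apply_lt_of_forall_Des {w : Equiv.Perm (Fin n)} {x y : ℕ} (hxy : x < y) (hy : y < n)
    (h : ∀ m, x < m → m ≤ y → m ∈ Des n w) : w ⟨y, hy⟩ < w ⟨x, hxy.trans hy⟩ := by
  induction y, hxy using Nat.le_induction with
  | base =>
    obtain ⟨_, h'⟩ := mem_Des.1 (h (x + 1) (by omega) le_rfl)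
    exact h'
  | succ y hxy ih =>
    obtain ⟨_, h'⟩ := mem_Des.1 (h (y + 1) (by omega) le_rfl)
    exact h'.trans (ih (by omega) fun m h1 h2 => h m h1 (by omega))

lemma word_mul_lt {w σ : Equiv.Perm (Fin n)} (hσ : σ ∈ G n (Des n w)) (h1 : σ ≠ 1) :
    word (w * σ) < word w := by
  have hex : ∃ x : Fin n, σ x ≠ x := by
    by_contra h
    push Not at h
    exact h1 (Equiv.ext h)
  obtain ⟨x, hx, hmin⟩ := WellFounded.has_min (wellFounded_lt (α := Fin n)) {x | σ x ≠ x} hex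
  have hfix : ∀ y < x, σ y = y := fun y hy => by
    by_contra h
    exact hmin y h hy
  have hlt : x < σ x := by
    refine lt_of_le_of_ne (le_of_not_gt fun h => ?_) (Ne.symm hx)
    exact hx (σ.injective (hfix _ h))
  refine ⟨x, fun y hy => ?_, ?_⟩
  · change w (σ y) = w y
    rw [hfix y hy]
  · change w (σ x) < w x
    refine apply_lt_of_forall_Des (x := x.val) (y := (σ x).val) hlt (σ x).2 fun m hm1 hm2 => ?_
    by_contra hm
    have := lt_iff_of_mem_G hσ hm x
    omega

lemma word_mul_sw_gt {w : Equiv.Perm (Fin n)} {p : ℕ} (hp : 1 ≤ p ∧ p < n)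
    (hD : p ∉ Des n w) : word w < word (w * sw n p) := by
  have hne : w ⟨p, hp.2⟩ ≠ w ⟨p - 1, by omega⟩ := fun h => by
    have := congrArg Fin.val (w.injective h)
    simp only at this
    omega
  have hlt : w ⟨p - 1, by omega⟩ < w ⟨p, hp.2⟩ :=
    lt_of_le_of_ne (le_of_not_gt fun h => hD (mem_Des.2 ⟨hp, h⟩)) hne.symm
  refine ⟨⟨p - 1, by omega⟩, fun y hy => ?_, ?_⟩
  · change w y = w (sw n p y)
    congr 1
    ext
    have hy' : y.val < p - 1 := hy
    rw [sw_apply_val hp]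
    split_ifs <;> omega
  · change w ⟨p - 1, _⟩ < w (sw n p ⟨p - 1, _⟩)
    have : sw n p ⟨p - 1, by omega⟩ = ⟨p, hp.2⟩ := by
      ext
      rw [sw_apply_val hp]
      simp
    rwa [this]

lemma aw_mul_sw (w : Equiv.Perm (Fin n)) {p : ℕ} (hp : p ∈ Des n w) :
    aw n k w * gr (sw n p) = aw n k w := by
  classical
  have hmem : sw n p ∈ G n (Des n w) :=
    Subgroup.subset_closure (Finset.mem_coe.2 (Finset.mem_image_of_mem _ hp))
  rw [aw, Finset.sum_mul]
  refine Finset.sum_equiv (Equiv.mulRight (sw n p)) (fun σ => ?_) (fun σ _ => ?_)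
  · simp [Subgroup.mul_mem_cancel_right _ hmem]
  · rw [← map_mul, mul_assoc]
    rfl

open scoped Classical in
lemma coeff_aw (w v : Equiv.Perm (Fin n)) :
    (aw n k w).coeff v = if w⁻¹ * v ∈ G n (Des n w) then 1 else 0 := by
  simp only [aw, MonoidAlgebra.of_apply, MonoidAlgebra.coeff_sum, MonoidAlgebra.coeff_single,
    Finsupp.finsetSum_apply, Finsupp.single_apply, ← eq_inv_mul_iff_mul_eq]
  simp

lemma coeff_aw_self (w : Equiv.Perm (Fin n)) : (aw n k w).coeff w = 1 := by
  classical
  rw [coeff_aw, inv_mul_cancel, if_pos (one_mem _)]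

lemma word_le_of_coeff_aw_ne_zero {w v : Equiv.Perm (Fin n)} (h : (aw n k w).coeff v ≠ 0) :
    word v ≤ word w := by
  classical
  rw [coeff_aw, ite_ne_right_iff] at h
  by_cases h1 : w⁻¹ * v = 1
  · rw [inv_mul_eq_one.1 h1]
  · simpa using (word_mul_lt h.1 h1).le

lemma coeff_mul_sw {q : MonoidAlgebra k (Equiv.Perm (Fin n))} {p : ℕ}
    (hq : q * gr (sw n p) = q) (v : Equiv.Perm (Fin n)) :
    q.coeff (v * sw n p) = q.coeff v := by
  nth_rewrite 1 [← hq]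
  rw [MonoidAlgebra.of_apply, MonoidAlgebra.coeff_mul_single_eq_coeff_mul v, mul_one]
  exact fun _ _ => mul_left_inj _

lemma mem_span_aw (T : Finset ℕ) (hT : T ⊆ Finset.Icc 1 (n - 1))
    (q : MonoidAlgebra k (Equiv.Perm (Fin n))) (hq : ∀ p ∈ T, q * gr (sw n p) = q) :
    q ∈ Submodule.span k {x | ∃ v : Equiv.Perm (Fin n), T ⊆ Des n v ∧ x = aw n k v} := by
  suffices H : ∀ (a : WithTop (Lex (Fin n → Fin n)))
      (q : MonoidAlgebra k (Equiv.Perm (Fin n))),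
      (∀ p ∈ T, q * gr (sw n p) = q) → (∀ v, q.coeff v ≠ 0 → (word v : WithTop _) < a) →
      q ∈ Submodule.span k {x | ∃ v : Equiv.Perm (Fin n), T ⊆ Des n v ∧ x = aw n k v} from
    H ⊤ q hq fun v _ => WithTop.coe_lt_top _
  intro a
  induction a using WellFoundedLT.induction with
  | _ a ih =>
  intro q hq ha
  rcases eq_or_ne q 0 with rfl | h0
  · exact Submodule.zero_mem _
  have hne : q.coeff.support.Nonempty :=
    Finsupp.support_nonempty_iff.2 fun h => h0 (MonoidAlgebra.coeff_eq_zero.1 h)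
  obtain ⟨u, hu, hmax⟩ := Finset.exists_max_image _ (word (n := n)) hne
  simp only [Finsupp.mem_support_iff] at hu hmax
  have hDes : T ⊆ Des n u := by
    intro p hp
    by_contra hpD
    have hp' := Finset.mem_Icc.1 (hT hp)
    refine (word_mul_sw_gt (by omega) hpD).not_ge (hmax _ ?_)
    rwa [coeff_mul_sw (hq p hp)]
  have hspan : aw n k u ∈
      Submodule.span k {x | ∃ v : Equiv.Perm (Fin n), T ⊆ Des n v ∧ x = aw n k v} :=
    Submodule.subset_span ⟨u, hDes, rfl⟩
  rw [← sub_add_cancel q (q.coeff u • aw n k u)]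
  refine Submodule.add_mem _ ?_ (Submodule.smul_mem _ _ hspan)
  set q' := q - q.coeff u • aw n k u with hq'
  have hcoeff : ∀ v, q'.coeff v = q.coeff v - q.coeff u * (aw n k u).coeff v := fun v => by
    simp [hq']
  have hlt : ∀ v, q'.coeff v ≠ 0 → word v < word u := by
    intro v hv
    refine lt_of_le_of_ne ?_ fun h => hv ?_
    · by_contra hle
      refine hv ?_
      rw [hcoeff, not_not.1 (mt (hmax v) hle), not_not.1 (mt word_le_of_coeff_aw_ne_zero hle),
        mul_zero, sub_zero]
    · rw [word_injective h, hcoeff, coeff_aw_self, mul_one, sub_self]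
  have hinv : ∀ p ∈ T, q' * gr (sw n p) = q' := fun p hp => by
    rw [hq', sub_mul, hq p hp, smul_mul_assoc, aw_mul_sw u (hDes hp)]
  exact ih (word u) (ha u hu) q' hinv fun v hv => WithTop.coe_lt_coe.2 (hlt v hv)

end Invariants

/-- Theorem `thm.Rcomb-conc`. For `w ∈ S_n`, `ℓ ∈ [n]` and
`i = Qind w`: `a_w t_ℓ − m_{Q_i,ℓ} a_w` is a `k`-linear combination of the `a_v` with
`Qind v < i`. -/
theorem aw_mul_t (n : ℕ) (k : Type*) [CommRing k]
    (Q : ℕ → Finset ℕ)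
    (hQlac : ∀ i ∈ Finset.Icc 1 (Nat.fib (n + 1)),
      Q i ⊆ Finset.Icc 1 (n - 1) ∧ Lacunar (Q i))
    (hQbij : ∀ J : Finset ℕ, J ⊆ Finset.Icc 1 (n - 1) → Lacunar J →
      ∃! i, i ∈ Finset.Icc 1 (Nat.fib (n + 1)) ∧ Q i = J)
    (hQmono : ∀ i ∈ Finset.Icc 1 (Nat.fib (n + 1)), ∀ j ∈ Finset.Icc 1 (Nat.fib (n + 1)),
      i ≤ j → (Q i).sum id ≤ (Q j).sum id)
    (w : Equiv.Perm (Fin n)) (l : ℕ) (hl : l ∈ Finset.Icc 1 n) (i : ℕ)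
    (hi : i = Qind n Q w) :
    aw n k w * t n k l - (mIdx n (Q i) l : k) • aw n k w ∈
      Submodule.span k {x : MonoidAlgebra k (Equiv.Perm (Fin n)) |
        ∃ v : Equiv.Perm (Fin n), Qind n Q v < i ∧ x = aw n k v} := by
  rw [hi]
  have hex : ∀ J : Finset ℕ, ∃ j ∈ Finset.Icc 1 (Nat.fib (n + 1)),
      (Q j).sum id ≤ J.sum id ∧ nonShadow n (Q j) ⊆ nonShadow n J := by
    intro J
    obtain ⟨K, hK1, hK2, hK3, hK4⟩ := exists_lacunar_nonShadow_subset n J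
    obtain ⟨j, ⟨hj, rfl⟩, -⟩ := hQbij K hK1 hK2
    exact ⟨j, hj, hK3, hK4⟩
  obtain ⟨h1, h2, hDes⟩ : Qind n Q w ∈
      {i : ℕ | 1 ≤ i ∧ i ≤ Nat.fib (n + 1) ∧ nonShadow n (Q i) ⊆ Des n w} := by
    apply Nat.sInf_mem
    obtain ⟨j, hj, -, hsub⟩ := hex (Finset.range n)
    rw [Finset.mem_Icc] at hj
    refine ⟨j, hj.1, hj.2, fun p hp => ?_⟩
    have := mem_nonShadow.1 (hsub hp)
    simp only [Finset.mem_range] at this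
    omega
  refine mul_t_sub_mem (fun p hp => aw_mul_sw w (hDes hp)) hl fun K hK => ?_
  obtain ⟨j, hj, hjK, hsub⟩ := hex K
  have hji : j < Qind n Q w := by
    by_contra h
    have := hQmono _ (Finset.mem_Icc.2 ⟨h1, h2⟩) j hj (not_lt.1 h)
    omega
  intro q hq
  refine Submodule.span_mono ?_ (mem_span_aw (nonShadow n (Q j)) Finset.sdiff_subset q
    fun p hp => hq p (hsub hp))
  rintro _ ⟨v, hv, rfl⟩
  rw [Finset.mem_Icc] at hj
  have hle : Qind n Q v ≤ j := Nat.sInf_le ⟨hj.1, hj.2, hv⟩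
  exact ⟨v, hle.trans_lt hji, rfl⟩

end OneSidedCycleShuffles
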